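/- arXiv:2412.13887 — 5 statements merged into one kernel-verified Lean document; each statement's English description precedes it below -/
import Mathlib

section
/- Fix a set N of 4 agents and a set R of 2 rooms, with additive utilities and binary valuations. For every α with 2/3 < α ≤ 1, there is no strategyproof mechanism that guarantees USW-α: for every mechanism M defined on all binary valuation profiles on N and R, if M guarantees USW-α then there exist a binary profile (v, v̂), an agent i, and a binary unilateral misreport (in fact one that changes only agent i's room valuation v̂_i) such that agent i's true additive utility strictly increases under the misreport. -/
open scoped BigOperators

/-- A roommate matching on agent set `N` and room set `R`: agents are paired up by a
fixed-point-free involution `partner`, roommates share a room, and each room hosts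
at most (hence, when `|N| = 2|R|`, exactly) one pair. -/
structure RMatching (N R : Type*) where
  partner : N → N
  room : N → R
  partner_ne : ∀ i, partner i ≠ i
  partner_invol : ∀ i, partner (partner i) = i
  room_partner : ∀ i, room (partner i) = room i
  room_pair : ∀ i j, room i = room j → j = i ∨ j = partner i

/-- Additive utility of agent `i` in matching `μ`. -/
noncomputable def uAdditive {N R : Type*} (v : N → N → ℝ) (vh : N → R → ℝ)
    (μ : RMatching N R) (i : N) : ℝ :=
  v i (μ.partner i) + vh i (μ.room i)

/-- Utilitarian social welfare under additive utilities. -/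
noncomputable def USWA {N R : Type*} [Fintype N] (v : N → N → ℝ) (vh : N → R → ℝ)
    (μ : RMatching N R) : ℝ :=
  ∑ i, uAdditive v vh μ i

/-- Binary (0/1) valuations. -/
def Binary {N R : Type*} (v : N → N → ℝ) (vh : N → R → ℝ) : Prop :=
  (∀ i j, v i j = 0 ∨ v i j = 1) ∧ (∀ i r, vh i r = 0 ∨ vh i r = 1)

/-- The roommate of agent `1` determines both pairs of a matching of four agents, and the two
pairs live in different rooms. -/
lemma RMatching.fin_four_cases (μ : RMatching (Fin 4) (Fin 2)) :
    (μ.partner 1 = 0 ∧ μ.partner 2 = 3 ∧ μ.partner 3 = 2 ∧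
      μ.room 2 ≠ μ.room 1 ∧ μ.room 3 = μ.room 2) ∨
    (μ.partner 1 = 2 ∧ μ.partner 2 = 1 ∧ μ.partner 3 = 0 ∧
      μ.room 2 = μ.room 1 ∧ μ.room 3 ≠ μ.room 1) ∨
    (μ.partner 1 = 3 ∧ μ.partner 3 = 1 ∧ μ.partner 2 = 0 ∧
      μ.room 3 = μ.room 1 ∧ μ.room 2 ≠ μ.room 1) := by
  have e : ∀ x : Fin 4, x = 0 ∨ x = 1 ∨ x = 2 ∨ x = 3 := by decide
  have n1 := μ.partner_ne 1
  have n2 := μ.partner_ne 2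
  have n3 := μ.partner_ne 3
  have i1 := μ.partner_invol 1
  have i2 := μ.partner_invol 2
  have i3 := μ.partner_invol 3
  have r1 := μ.room_partner 1
  have r2 := μ.room_partner 2
  have r3 := μ.room_partner 3
  have p12 := μ.room_pair 1 2
  have p13 := μ.room_pair 1 3
  rcases e (μ.partner 1) with h1 | h1 | h1 | h1 <;>
  rcases e (μ.partner 2) with h2 | h2 | h2 | h2 <;>
  rcases e (μ.partner 3) with h3 | h3 | h3 | h3 <;>
  grind

/-- Agents `2` and `3` want agent `1` as roommate; nobody else is wanted. -/
def rivalCompat : Fin 4 → Fin 4 → ℝ :=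
  ![![0, 0, 0, 0], ![0, 0, 0, 0], ![0, 1, 0, 0], ![0, 1, 0, 0]]

/-- Only room `0` is wanted: by agent `1`, and by agents `2` and `3` to the extent `a` and `b`. -/
def rivalRooms (a b : ℝ) : Fin 4 → Fin 2 → ℝ :=
  ![![0, 0], ![1, 0], ![a, 0], ![b, 0]]

lemma binary_rival {a b : ℝ} (ha : a = 0 ∨ a = 1) (hb : b = 0 ∨ b = 1) :
    Binary rivalCompat (rivalRooms a b) := by
  constructor
  · intro i j
    fin_cases i <;> fin_cases j <;> simp [rivalCompat]
  · intro i r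
    fin_cases i <;> fin_cases r <;> simp [rivalRooms, ha, hb]

/-- Agents `1` and `2` share room `0`. -/
def matchingOneTwo : RMatching (Fin 4) (Fin 2) where
  partner := ![3, 2, 1, 0]
  room := ![1, 0, 0, 1]
  partner_ne := by decide
  partner_invol := by decide
  room_partner := by decide
  room_pair := by decide

/-- Agents `1` and `3` share room `0`. -/
def matchingOneThree : RMatching (Fin 4) (Fin 2) where
  partner := ![2, 3, 0, 1]
  room := ![1, 0, 1, 0]
  partner_ne := by decide
  partner_invol := by decide
  room_partner := by decide
  room_pair := by decide

lemma USWA_matchingOneTwo (a b : ℝ) :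
    USWA rivalCompat (rivalRooms a b) matchingOneTwo = 2 + a := by
  simp [USWA, uAdditive, Fin.sum_univ_four, rivalCompat, rivalRooms, matchingOneTwo]
  ring

lemma USWA_matchingOneThree (a b : ℝ) :
    USWA rivalCompat (rivalRooms a b) matchingOneThree = 2 + b := by
  simp [USWA, uAdditive, Fin.sum_univ_four, rivalCompat, rivalRooms, matchingOneThree]
  ring

/-- Welfare above `2` forces agent `1` into room `0` together with a rival who wants that room. -/
lemma rival_of_two_lt_USWA {a b : ℝ} (ha : a = 0 ∨ a = 1) (hb : b = 0 ∨ b = 1)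
    (μ : RMatching (Fin 4) (Fin 2)) (h : 2 < USWA rivalCompat (rivalRooms a b) μ) :
    (a = 1 ∧ μ.partner 2 = 1 ∧ μ.room 2 = 0 ∧ μ.partner 3 = 0 ∧ μ.room 3 = 1) ∨
    (b = 1 ∧ μ.partner 3 = 1 ∧ μ.room 3 = 0 ∧ μ.partner 2 = 0 ∧ μ.room 2 = 1) := by
  have e : ∀ x : Fin 2, x = 0 ∨ x = 1 := by decide
  have hv : ∀ x, rivalCompat 0 x = 0 := by simp [rivalCompat, Fin.forall_fin_succ]
  have hvh : ∀ x, rivalRooms a b 0 x = 0 := by simp [rivalRooms, Fin.forall_fin_succ]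
  simp only [USWA, uAdditive, Fin.sum_univ_four, hv, hvh] at h
  rcases μ.fin_four_cases with ⟨h1, h2, h3, r, s⟩ | ⟨h1, h2, h3, r, s⟩ | ⟨h1, h2, h3, r, s⟩ <;>
  rcases e (μ.room 1) with k1 | k1 <;> rcases e (μ.room 2) with k2 | k2 <;>
  rcases e (μ.room 3) with k3 | k3 <;> rcases ha with rfl | rfl <;> rcases hb with rfl | rfl <;>
  simp_all [rivalCompat, rivalRooms] <;> norm_num at h

/-- Under binary valuations and additive utilities, no mechanism on 4 agents and 2 rooms
that guarantees an `α`-fraction of the optimal social welfare for `α > 2/3` can be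
strategyproof: some agent can strictly gain by misreporting only its (binary) room
valuation. -/
theorem no_SP_beyond_two_thirds_binary_additive (α : ℝ) (hα0 : 2 / 3 < α) (hα1 : α ≤ 1)
    (M : (Fin 4 → Fin 4 → ℝ) → (Fin 4 → Fin 2 → ℝ) → RMatching (Fin 4) (Fin 2))
    (husw : ∀ (v : Fin 4 → Fin 4 → ℝ) (vh : Fin 4 → Fin 2 → ℝ), Binary v vh →
      ∀ μ : RMatching (Fin 4) (Fin 2), α * USWA v vh μ ≤ USWA v vh (M v vh)) :
    ∃ (v : Fin 4 → Fin 4 → ℝ) (vh : Fin 4 → Fin 2 → ℝ),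
      Binary v vh ∧
      ∃ (i : Fin 4) (vhi' : Fin 2 → ℝ),
        (∀ r, vhi' r = 0 ∨ vhi' r = 1) ∧
        uAdditive v vh (M v vh) i <
          uAdditive v vh (M v (Function.update vh i vhi')) i := by
  have key : ∀ a b : ℝ, (a = 0 ∨ a = 1) → (b = 0 ∨ b = 1) → (a = 1 ∨ b = 1) →
      2 < USWA rivalCompat (rivalRooms a b) (M rivalCompat (rivalRooms a b)) := by
    intro a b ha hb hab
    have hM := husw _ _ (binary_rival ha hb)
    rcases hab with rfl | rfl
    · have := hM matchingOneTwo
      rw [USWA_matchingOneTwo] at this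
      linarith
    · have := hM matchingOneThree
      rw [USWA_matchingOneThree] at this
      linarith
  have both := rival_of_two_lt_USWA (.inr rfl) (.inr rfl) _ (key 1 1 (by simp) (by simp) (by simp))
  rcases both with ⟨-, hp, hr, -, -⟩ | ⟨-, hp, hr, -, -⟩
  · refine ⟨rivalCompat, rivalRooms 0 1, binary_rival (.inl rfl) (.inr rfl), 2, ![1, 0],
      by simp [Fin.forall_fin_two], ?_⟩
    have hupd : Function.update (rivalRooms 0 1) 2 ![1, 0] = rivalRooms 1 1 := by
      funext i
      fin_cases i <;> simp [rivalRooms, Function.update]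
    rcases rival_of_two_lt_USWA (.inl rfl) (.inr rfl) _ (key 0 1 (by simp) (by simp) (by simp))
      with ⟨h, -⟩ | ⟨-, -, -, hp', hr'⟩
    · norm_num at h
    · rw [hupd, uAdditive, uAdditive, hp, hr, hp', hr']
      simp [rivalCompat, rivalRooms]
  · refine ⟨rivalCompat, rivalRooms 1 0, binary_rival (.inr rfl) (.inl rfl), 3, ![1, 0],
      by simp [Fin.forall_fin_two], ?_⟩
    have hupd : Function.update (rivalRooms 1 0) 3 ![1, 0] = rivalRooms 1 1 := by
      funext i
      fin_cases i <;> simp [rivalRooms, Function.update]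
    rcases rival_of_two_lt_USWA (.inr rfl) (.inl rfl) _ (key 1 0 (by simp) (by simp) (by simp))
      with ⟨-, -, -, hp', hr'⟩ | ⟨h, -⟩
    · rw [hupd, uAdditive, uAdditive, hp, hr, hp', hr']
      simp [rivalCompat, rivalRooms]
    · norm_num at h
end

section
/- Suppose each agent i ∈ N (|N| = 2n, |R| = n) reports an arbitrary {0,1}-valued utility function u_i over pairs (j, r) of a possible roommate j ∈ N\{i} and room r ∈ R, and the Welfare Set Reduction mechanism is run with these reported utilities. Then: (a) S_{2n} is nonempty and every matching in S_{2n} maximizes the reported social welfare; and (b) for every agent i with true {0,1}-valued utility function u_i, every misreported {0,1}-valued utility function u_i' (all other agents truthful), every μ ∈ S_{2n} computed from the truthful report, and every μ' ∈ S_{2n} computed from the misreported profile, agent i's true utility satisfies u_i(μ) ≥ u_i(μ'). -/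
open scoped BigOperators

/-- Social welfare for an abstract profile `u` of per-agent utilities over matchings. -/
noncomputable def USWu {N R : Type*} [Fintype N] (u : N → RMatching N R → ℝ)
    (μ : RMatching N R) : ℝ :=
  ∑ i, u i μ

/-- One step of the Welfare Set Reduction mechanism: restrict `S` to the matchings
maximizing agent `a`'s utility over `S`. -/
def wsrStep {N R : Type*} (u : N → RMatching N R → ℝ)
    (S : Set (RMatching N R)) (a : N) : Set (RMatching N R) :=
  {μ ∈ S | ∀ μ' ∈ S, u a μ' ≤ u a μ}

/-- The final set `S_{2n}` of the Welfare Set Reduction mechanism: start with all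
maximum-welfare matchings and successively reduce along the agent ordering `L`. -/
noncomputable def WSR {N R : Type*} [Fintype N] (u : N → RMatching N R → ℝ)
    (L : List N) : Set (RMatching N R) :=
  L.foldl (wsrStep u) {μ | ∀ μ', USWu u μ' ≤ USWu u μ}

/-- The matching-utility functions induced by reported `{0,1}`-valued utility
functions over (roommate, room) pairs. -/
def inducedU {N R : Type*} (u : N → N → R → ℝ) : N → RMatching N R → ℝ :=
  fun a μ => u a (μ.partner a) (μ.room a)

instance RMatching.finite {N R : Type*} [Finite N] [Finite R] : Finite (RMatching N R) :=
  Finite.of_injective (fun μ : RMatching N R => (μ.partner, μ.room)) fun μ ν h => by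
    cases μ
    cases ν
    simp_all

/-- A bijection of the agents with the beds, two in each room, gives a roommate matching. -/
def RMatching.ofEquiv {N R : Type*} (e : N ≃ R × Bool) : RMatching N R where
  partner i := e.symm ((e i).1, !(e i).2)
  room i := (e i).1
  partner_ne i h := by
    have h' := congrArg (fun j => (e j).2) h
    simp at h'
  partner_invol i := by simp
  room_partner i := by simp
  room_pair i j h := by
    by_cases hb : (e i).2 = (e j).2
    · exact Or.inl (e.injective (Prod.ext h.symm hb.symm))
    · refine Or.inr ((Equiv.eq_symm_apply e).2 (Prod.ext h.symm ?_))
      simpa using Bool.eq_not.2 (Ne.symm hb)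

theorem RMatching.nonempty_of_card {N R : Type*} [Fintype N] [Fintype R]
    (h : Fintype.card N = 2 * Fintype.card R) : Nonempty (RMatching N R) :=
  ⟨.ofEquiv (Fintype.equivOfCardEq (by simp [h, mul_comm]))⟩

theorem foldl_wsrStep_subset {N R : Type*} (u : N → RMatching N R → ℝ) (L : List N)
    (S : Set (RMatching N R)) : L.foldl (wsrStep u) S ⊆ S := by
  induction L generalizing S with
  | nil => exact subset_rfl
  | cons a L ih => exact (ih _).trans fun _ h => h.1

theorem foldl_wsrStep_nonempty {N R : Type*} [Finite N] [Finite R]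
    (u : N → RMatching N R → ℝ) (L : List N) {S : Set (RMatching N R)} (hS : S.Nonempty) :
    (L.foldl (wsrStep u) S).Nonempty := by
  induction L generalizing S with
  | nil => exact hS
  | cons a L ih =>
    obtain ⟨μ, hμ, hmax⟩ := S.exists_max_image (u a) S.toFinite hS
    exact ih ⟨μ, hμ, hmax⟩

theorem WSR_nonempty {N R : Type*} [Fintype N] [Finite R] [Nonempty (RMatching N R)]
    (u : N → RMatching N R → ℝ) (L : List N) : (WSR u L).Nonempty :=
  foldl_wsrStep_nonempty u L (Finite.exists_max (USWu u))

theorem USWu_le_of_mem_WSR {N R : Type*} [Fintype N] {u : N → RMatching N R → ℝ} {L : List N}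
    {μ : RMatching N R} (h : μ ∈ WSR u L) (μ' : RMatching N R) : USWu u μ' ≤ USWu u μ :=
  foldl_wsrStep_subset u L _ h μ'

/-- If `μ` survives the reduction of `S` along `L` under `u`, and `μ'` that of `T` under `v`,
while both lie in `S ∩ T` and both are valued alike by `u` and `v`, then no agent in `L`
distinguishes `μ` from `μ'`. -/
theorem eq_of_mem_foldl_wsrStep {N R : Type*} {u v : N → RMatching N R → ℝ} {L : List N}
    {S T : Set (RMatching N R)} {μ μ' : RMatching N R}
    (hμ : μ ∈ L.foldl (wsrStep u) S) (hμ' : μ' ∈ L.foldl (wsrStep v) T)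
    (hμ'S : μ' ∈ S) (hμT : μ ∈ T)
    (huv : ∀ a, u a μ = v a μ) (huv' : ∀ a, u a μ' = v a μ') :
    ∀ a ∈ L, u a μ = u a μ' := by
  induction L generalizing S T with
  | nil => simp
  | cons b L ih =>
    have hS := foldl_wsrStep_subset u L _ hμ
    have hT := foldl_wsrStep_subset v L _ hμ'
    have hb : u b μ = u b μ' :=
      le_antisymm (by simpa only [huv, huv'] using hT.2 μ hμT) (hS.2 μ' hμ'S)
    have hb' : v b μ = v b μ' := by rw [← huv, ← huv', hb]
    have key := ih hμ hμ' ⟨hμ'S, fun ν hν => (hS.2 ν hν).trans hb.le⟩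
      ⟨hμT, fun ν hν => (hT.2 ν hν).trans hb'.ge⟩
    intro a ha
    rcases List.mem_cons.1 ha with rfl | ha
    · exact hb
    · exact key a ha

/-- For arbitrary reported `{0,1}`-valued utility functions over (roommate, room) pairs,
the Welfare Set Reduction mechanism (along any agent ordering `L`) has a nonempty final
set, every matching in it maximizes the reported social welfare, and it is strategyproof:
no `{0,1}`-valued unilateral misreport can strictly increase an agent's true utility,
whichever matchings are selected from the final sets. -/
theorem welfare_set_reduction_binary_utilities_maxUSW_and_SP
    {N R : Type*} [Fintype N] [Fintype R] [DecidableEq N] (n : ℕ)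
    (hN : Fintype.card N = 2 * n) (hR : Fintype.card R = n)
    (u : N → N → R → ℝ) (hbin : ∀ i j r, u i j r = 0 ∨ u i j r = 1)
    (L : List N) (hnd : L.Nodup) (hfull : ∀ a : N, a ∈ L) :
    (WSR (inducedU u) L).Nonempty ∧
    (∀ μ ∈ WSR (inducedU u) L,
      ∀ μ' : RMatching N R, USWu (inducedU u) μ' ≤ USWu (inducedU u) μ) ∧
    (∀ (i : N) (u' : N → R → ℝ), (∀ j r, u' j r = 0 ∨ u' j r = 1) →
      ∀ μ ∈ WSR (inducedU u) L,
      ∀ μ' ∈ WSR (inducedU (Function.update u i u')) L,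
        u i (μ'.partner i) (μ'.room i) ≤ u i (μ.partner i) (μ.room i)) := by
  have : Nonempty (RMatching N R) := RMatching.nonempty_of_card (by rw [hN, hR])
  refine ⟨WSR_nonempty _ L, fun μ hμ => USWu_le_of_mem_WSR hμ, ?_⟩
  intro i u' hbin' μ hμ μ' hμ'
  by_contra! hlt
  have h0 : u i (μ.partner i) (μ.room i) = 0 := by
    rcases hbin i (μ.partner i) (μ.room i) with h | h <;>
      rcases hbin i (μ'.partner i) (μ'.room i) with h' | h' <;> linarith
  have h1 : u i (μ'.partner i) (μ'.room i) = 1 := by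
    rcases hbin i (μ'.partner i) (μ'.room i) with h' | h' <;> linarith
  have hW : ∀ ν : RMatching N R, USWu (inducedU (Function.update u i u')) ν
      = USWu (inducedU u) ν - u i (ν.partner i) (ν.room i) + u' (ν.partner i) (ν.room i) := by
    intro ν
    have hrest : ∑ a ∈ Finset.univ.erase i, inducedU (Function.update u i u') a ν
        = ∑ a ∈ Finset.univ.erase i, inducedU u a ν :=
      Finset.sum_congr rfl fun a ha => by
        simp [inducedU, Function.update_of_ne (Finset.ne_of_mem_erase ha)]
    rw [USWu, USWu, ← Finset.add_sum_erase _ _ (Finset.mem_univ i), hrest,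
      ← Finset.add_sum_erase _ (fun a => inducedU u a ν) (Finset.mem_univ i)]
    simp only [inducedU, Function.update_self]
    ring
  have hopt := USWu_le_of_mem_WSR hμ
  have hopt' := USWu_le_of_mem_WSR hμ'
  have hle := hopt μ'
  have hle' := hopt' μ
  have hWμ := hW μ
  have hWμ' := hW μ'
  have h0' : u' (μ.partner i) (μ.room i) = 0 := by
    rcases hbin' (μ.partner i) (μ.room i) with h | h <;>
      rcases hbin' (μ'.partner i) (μ'.room i) with h' | h' <;> linarith
  have h1' : u' (μ'.partner i) (μ'.room i) = 1 := by
    rcases hbin' (μ'.partner i) (μ'.room i) with h' | h' <;> linarith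
  have hagree : ∀ ν : RMatching N R,
      u' (ν.partner i) (ν.room i) = u i (ν.partner i) (ν.room i) →
      ∀ a, inducedU u a ν = inducedU (Function.update u i u') a ν := by
    intro ν hν a
    by_cases ha : a = i
    · subst ha
      simp [inducedU, hν]
    · simp [inducedU, ha]
  have heq := eq_of_mem_foldl_wsrStep hμ hμ'
    (fun ν => (hopt ν).trans (by linarith)) (fun ν => (hopt' ν).trans (by linarith))
    (hagree μ (by rw [h0, h0'])) (hagree μ' (by rw [h1, h1'])) i (hfull i)
  exact hlt.ne heq
end

section
/- Under binary valuations and Leontief utilities, the L/T Serial Dictatorship mechanism is strategyproof and achieves at least one sixth of the maximum social welfare. Precisely: fix a priority ordering σ over the agents, for each agent a deterministic selection rule that, whenever the agent's turn comes and some pair (j, r) of an unmatched agent j and unmatched room r with v_i(j) = v̂_i(r) = 1 exists, selects one such pair as a function only of agent i's reported valuations and the set of remaining agents and rooms, and a fixed report-independent rule completing the matching on leftover agents and rooms. Then: (a) for every binary profile, every agent i, and every binary unilateral misreport, agent i's true Leontief utility under the truthful outcome is at least its true Leontief utility under the misreported outcome; and (b) the output matching μ satisfies USW(μ) ≥ (1/6)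 · max_{μ'} USW(μ'). -/
open scoped BigOperators
open scoped Classical

/-- Leontief utility of agent `i` in matching `μ`. -/
noncomputable def uLeontief {N R : Type*} (v : N → N → ℝ) (vh : N → R → ℝ)
    (μ : RMatching N R) (i : N) : ℝ :=
  min (v i (μ.partner i)) (vh i (μ.room i))

/-- Utilitarian social welfare under Leontief utilities. -/
noncomputable def USWL {N R : Type*} [Fintype N] (v : N → N → ℝ) (vh : N → R → ℝ)
    (μ : RMatching N R) : ℝ :=
  ∑ i, uLeontief v vh μ i

/-- Two triples are disjoint: they share no agent and no room. -/
def TripleDisj {N R : Type*} (t t' : N × N × R) : Prop :=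
  t.1 ≠ t'.1 ∧ t.1 ≠ t'.2.1 ∧ t.2.1 ≠ t'.1 ∧ t.2.1 ≠ t'.2.1 ∧ t.2.2 ≠ t'.2.2

/-- The true Leontief utility of agent `a` in a list of triples. -/
noncomputable def listUtilL {N R : Type*} [DecidableEq N] (v : N → N → ℝ)
    (vh : N → R → ℝ) (a : N) (ts : List (N × N × R)) : ℝ :=
  (ts.map (fun t =>
    if a = t.1 then min (v a t.2.1) (vh a t.2.2)
    else if a = t.2.1 then min (v a t.1) (vh a t.2.2)
    else 0)).sum

/-- The dictatorship phase of the L/T Serial Dictatorship mechanism: agents are called in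
the priority order; a still-unmatched called agent `a` that values some remaining
(agent, room) pair (i.e. `v a j = 1` and `vh a r = 1`) is matched into the triple given
by its selection rule `sel` (a function of its own reported valuations and the remaining
agents and rooms only); otherwise it is skipped. -/
noncomputable def ltsdRun {N R : Type*} [DecidableEq N] [DecidableEq R]
    (sel : N → (N → ℝ) → (R → ℝ) → Finset N → Finset R → N × R)
    (v : N → N → ℝ) (vh : N → R → ℝ) :
    List N → Finset N → Finset R → List (N × N × R)
  | [], _, _ => []
  | a :: L, A, B =>
    if a ∈ A ∧ ∃ j ∈ A.erase a, ∃ r ∈ B, v a j = 1 ∧ vh a r = 1 then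
      (a, (sel a (v a) (vh a) (A.erase a) B).1, (sel a (v a) (vh a) (A.erase a) B).2) ::
        ltsdRun sel v vh L ((A.erase a).erase (sel a (v a) (vh a) (A.erase a) B).1)
          (B.erase (sel a (v a) (vh a) (A.erase a) B).2)
    else ltsdRun sel v vh L A B

/-- Unmatched agents after a partial run. -/
def leftA {N R : Type*} [Fintype N] [DecidableEq N] (ts : List (N × N × R)) : Finset N :=
  Finset.univ.filter fun a => ∀ t ∈ ts, a ≠ t.1 ∧ a ≠ t.2.1

/-- Unmatched rooms after a partial run. -/
def leftR {N R : Type*} [Fintype R] [DecidableEq R] (ts : List (N × N × R)) : Finset R :=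
  Finset.univ.filter fun r => ∀ t ∈ ts, r ≠ t.2.2

/-- The full output of the L/T Serial Dictatorship mechanism: the dictatorship phase
followed by the (report-independent) completion rule `comp` on the leftover agents and
rooms. -/
noncomputable def ltsdOutput {N R : Type*} [Fintype N] [Fintype R]
    [DecidableEq N] [DecidableEq R]
    (sel : N → (N → ℝ) → (R → ℝ) → Finset N → Finset R → N × R)
    (comp : Finset N → Finset R → List (N × N × R))
    (v : N → N → ℝ) (vh : N → R → ℝ) (L : List N) : List (N × N × R) :=
  ltsdRun sel v vh L Finset.univ Finset.univ ++
    comp (leftA (ltsdRun sel v vh L Finset.univ Finset.univ))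
      (leftR (ltsdRun sel v vh L Finset.univ Finset.univ))

/-- The triple the L/T Serial Dictatorship creates when `a` chooses from `A` and `B`. -/
noncomputable def ltsdTriple {N R : Type*} [DecidableEq N]
    (sel : N → (N → ℝ) → (R → ℝ) → Finset N → Finset R → N × R)
    (v : N → N → ℝ) (vh : N → R → ℝ) (a : N) (A : Finset N) (B : Finset R) : N × N × R :=
  (a, sel a (v a) (vh a) (A.erase a) B)

/-- Agent `a` is in `A` and values some agent-room pair available in `A` and `B`. -/
def LTCanChoose {N R : Type*} [DecidableEq N]
    (v : N → N → ℝ) (vh : N → R → ℝ) (a : N) (A : Finset N) (B : Finset R) : Prop :=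
  a ∈ A ∧ ∃ j ∈ A.erase a, ∃ r ∈ B, v a j = 1 ∧ vh a r = 1

/-- The L/T Serial Dictatorship started from the agents `A` and the rooms `B`, followed by the
completion rule. -/
noncomputable def ltsdFrom {N R : Type*} [Fintype N] [Fintype R] [DecidableEq N] [DecidableEq R]
    (sel : N → (N → ℝ) → (R → ℝ) → Finset N → Finset R → N × R)
    (comp : Finset N → Finset R → List (N × N × R))
    (v : N → N → ℝ) (vh : N → R → ℝ) (L : List N) (A : Finset N) (B : Finset R) :
    List (N × N × R) :=
  ltsdRun sel v vh L A B ++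
    comp (A ∩ leftA (ltsdRun sel v vh L A B)) (B ∩ leftR (ltsdRun sel v vh L A B))

/-- `ts` is a list of disjoint triples with agents from `A` and rooms from `B`. -/
structure IsTripleList {N R : Type*} (A : Finset N) (B : Finset R) (ts : List (N × N × R)) :
    Prop where
  mem : ∀ t ∈ ts, t.1 ∈ A ∧ t.2.1 ∈ A ∧ t.2.2 ∈ B ∧ t.1 ≠ t.2.1
  disj : ts.Pairwise TripleDisj

section LTSD

variable {N R : Type*} {v : N → N → ℝ} {vh : N → R → ℝ}

theorem Binary.min_nonneg (h : Binary v vh) (a j : N) (r : R) : 0 ≤ min (v a j) (vh a r) := by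
  rcases h.1 a j with h₁ | h₁ <;> rcases h.2 a r with h₂ | h₂ <;> simp [h₁, h₂]

theorem Binary.min_le_one (h : Binary v vh) (a j : N) (r : R) : min (v a j) (vh a r) ≤ 1 := by
  rcases h.1 a j with h₁ | h₁ <;> rcases h.2 a r with h₂ | h₂ <;> simp [h₁, h₂]

theorem Binary.min_eq_zero (h : Binary v vh) {a j : N} {r : R} (hn : ¬(v a j = 1 ∧ vh a r = 1)) :
    min (v a j) (vh a r) = 0 := by
  rcases h.1 a j with h₁ | h₁ <;> rcases h.2 a r with h₂ | h₂ <;> simp_all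

theorem Binary.USWL_eq_card [Fintype N] (h : Binary v vh) (μ : RMatching N R) :
    USWL v vh μ =
      (Finset.univ.filter fun i => v i (μ.partner i) = 1 ∧ vh i (μ.room i) = 1).card := by
  rw [USWL, Finset.card_filter, Nat.cast_sum]
  refine Finset.sum_congr rfl fun i _ => ?_
  rw [uLeontief]
  split_ifs with hi
  · simp [hi.1, hi.2]
  · simp [h.min_eq_zero hi]

variable [DecidableEq N]

theorem listUtilL_cons (a : N) (t : N × N × R) (ts : List (N × N × R)) :
    listUtilL v vh a (t :: ts) =
      (if a = t.1 then min (v a t.2.1) (vh a t.2.2)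
        else if a = t.2.1 then min (v a t.1) (vh a t.2.2) else 0) + listUtilL v vh a ts := by
  simp [listUtilL]

theorem listUtilL_append (a : N) (ts ts' : List (N × N × R)) :
    listUtilL v vh a (ts ++ ts') = listUtilL v vh a ts + listUtilL v vh a ts' := by
  simp [listUtilL]

theorem Binary.triple_util_nonneg (h : Binary v vh) (a : N) (t : N × N × R) :
    0 ≤ (if a = t.1 then min (v a t.2.1) (vh a t.2.2)
        else if a = t.2.1 then min (v a t.1) (vh a t.2.2) else 0) := by
  split_ifs
  exacts [h.min_nonneg _ _ _, h.min_nonneg _ _ _, le_rfl]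

theorem Binary.listUtilL_nonneg (h : Binary v vh) (a : N) (ts : List (N × N × R)) :
    0 ≤ listUtilL v vh a ts := by
  induction ts with
  | nil => simp [listUtilL]
  | cons t ts ih =>
    rw [listUtilL_cons]
    exact add_nonneg (h.triple_util_nonneg a t) ih

theorem listUtilL_eq_zero {a : N} {ts : List (N × N × R)}
    (h : ∀ t ∈ ts, (a = t.1 → min (v a t.2.1) (vh a t.2.2) = 0) ∧
      (a = t.2.1 → min (v a t.1) (vh a t.2.2) = 0)) :
    listUtilL v vh a ts = 0 := by
  induction ts with
  | nil => simp [listUtilL]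
  | cons t ts ih =>
    rw [listUtilL_cons, ih fun t' ht' => h t' (List.mem_cons_of_mem _ ht'), add_zero]
    obtain ⟨h₁, h₂⟩ := h t List.mem_cons_self
    split_ifs with h₃ h₄
    exacts [h₁ h₃, h₂ h₄, rfl]

theorem IsTripleList.listUtilL_eq_zero_of_notMem {A : Finset N} {B : Finset R}
    {ts : List (N × N × R)} (hts : IsTripleList A B ts) {a : N} (ha : a ∉ A) :
    listUtilL v vh a ts = 0 :=
  listUtilL_eq_zero fun t ht =>
    ⟨fun e => absurd (e ▸ (hts.mem t ht).1) ha, fun e => absurd (e ▸ (hts.mem t ht).2.1) ha⟩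

theorem Binary.listUtilL_le_one (h : Binary v vh) (a : N) {ts : List (N × N × R)}
    (hts : ts.Pairwise TripleDisj) : listUtilL v vh a ts ≤ 1 := by
  induction ts with
  | nil => simp [listUtilL]
  | cons t ts ih =>
    rw [List.pairwise_cons] at hts
    rw [listUtilL_cons]
    by_cases ha : a = t.1 ∨ a = t.2.1
    · have h0 : listUtilL v vh a ts = 0 := listUtilL_eq_zero fun t' ht' => by
        obtain ⟨h₁, h₂, h₃, h₄, -⟩ := hts.1 t' ht'
        rcases ha with rfl | rfl
        · exact ⟨fun e => absurd e h₁, fun e => absurd e h₂⟩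
        · exact ⟨fun e => absurd e h₃, fun e => absurd e h₄⟩
      rw [h0, add_zero]
      split_ifs
      exacts [h.min_le_one _ _ _, h.min_le_one _ _ _, zero_le_one]
    · rw [not_or] at ha
      rw [if_neg ha.1, if_neg ha.2, zero_add]
      exact ih hts.2

theorem Binary.length_le_sum_listUtilL [Fintype N] (h : Binary v vh) {ts : List (N × N × R)}
    (hts : ∀ t ∈ ts, v t.1 t.2.1 = 1 ∧ vh t.1 t.2.2 = 1) :
    (ts.length : ℝ) ≤ ∑ a, listUtilL v vh a ts := by
  induction ts with
  | nil => simp [listUtilL]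
  | cons t ts ih =>
    simp only [listUtilL_cons, Finset.sum_add_distrib, List.length_cons, Nat.cast_succ]
    have ht := hts t List.mem_cons_self
    have h₁ := Finset.single_le_sum (fun a _ => h.triple_util_nonneg a t) (Finset.mem_univ t.1)
    rw [if_pos rfl, ht.1, ht.2, min_self] at h₁
    linarith [ih fun t' ht' => hts t' (List.mem_cons_of_mem _ ht')]

section Run

variable {sel : N → (N → ℝ) → (R → ℝ) → Finset N → Finset R → N × R}

theorem ltsdTriple_fst {a : N} {A : Finset N} {B : Finset R} :
    (ltsdTriple sel v vh a A B).1 = a := rfl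

/-- A selection rule that picks a valued pair whenever one is available. -/
def ValidSel (sel : N → (N → ℝ) → (R → ℝ) → Finset N → Finset R → N × R) : Prop :=
  ∀ (a : N) (va : N → ℝ) (vha : R → ℝ) (A : Finset N) (B : Finset R),
    (∃ j ∈ A, ∃ r ∈ B, va j = 1 ∧ vha r = 1) →
    (sel a va vha A B).1 ∈ A ∧ (sel a va vha A B).2 ∈ B ∧
      va (sel a va vha A B).1 = 1 ∧ vha (sel a va vha A B).2 = 1

theorem ValidSel.triple_mem (hsel : ValidSel sel) {a : N} {A : Finset N} {B : Finset R}
    (h : LTCanChoose v vh a A B) :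
    (ltsdTriple sel v vh a A B).2.1 ∈ A.erase a ∧ (ltsdTriple sel v vh a A B).2.2 ∈ B ∧
      v a (ltsdTriple sel v vh a A B).2.1 = 1 ∧ vh a (ltsdTriple sel v vh a A B).2.2 = 1 :=
  hsel a (v a) (vh a) (A.erase a) B h.2

variable [DecidableEq R]

theorem ltsdRun_cons_of_canChoose {a : N} {A : Finset N} {B : Finset R}
    (h : LTCanChoose v vh a A B) (L : List N) :
    ltsdRun sel v vh (a :: L) A B =
      ltsdTriple sel v vh a A B ::
        ltsdRun sel v vh L ((A.erase a).erase (ltsdTriple sel v vh a A B).2.1)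
          (B.erase (ltsdTriple sel v vh a A B).2.2) := by
  rw [ltsdRun]
  exact if_pos h

theorem ltsdRun_cons_of_not_canChoose {a : N} {A : Finset N} {B : Finset R}
    (h : ¬LTCanChoose v vh a A B) (L : List N) :
    ltsdRun sel v vh (a :: L) A B = ltsdRun sel v vh L A B := by
  rw [ltsdRun]
  exact if_neg h

theorem ValidSel.card_erase (hsel : ValidSel sel) {a : N} {A : Finset N} {B : Finset R}
    (h : LTCanChoose v vh a A B) (hc : A.card = 2 * B.card) :
    ((A.erase a).erase (ltsdTriple sel v vh a A B).2.1).card =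
      2 * (B.erase (ltsdTriple sel v vh a A B).2.2).card := by
  obtain ⟨h₁, h₂, -⟩ := hsel.triple_mem h
  rw [Finset.card_erase_of_mem h₁, Finset.card_erase_of_mem h.1, Finset.card_erase_of_mem h₂]
  omega

theorem ValidSel.run_values (hsel : ValidSel sel) (L : List N) (A : Finset N) (B : Finset R) :
    ∀ t ∈ ltsdRun sel v vh L A B, v t.1 t.2.1 = 1 ∧ vh t.1 t.2.2 = 1 := by
  induction L generalizing A B with
  | nil => simp [ltsdRun]
  | cons a L ih =>
    by_cases h : LTCanChoose v vh a A B
    · rw [ltsdRun_cons_of_canChoose h, List.forall_mem_cons]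
      exact ⟨(hsel.triple_mem h).2.2, ih _ _⟩
    · rw [ltsdRun_cons_of_not_canChoose h]
      exact ih _ _

theorem card_filter_room_eq_le_two [Fintype N] (μ : RMatching N R) (r : R) :
    (Finset.univ.filter fun i => μ.room i = r).card ≤ 2 := by
  rcases Finset.eq_empty_or_nonempty (Finset.univ.filter fun i => μ.room i = r) with h | ⟨i, hi⟩
  · simp [h]
  · refine (Finset.card_le_card (t := {i, μ.partner i}) fun j hj => ?_).trans Finset.card_le_two
    simp only [Finset.mem_filter, Finset.mem_univ, true_and] at hi hj
    simpa using μ.room_pair i j (hi.trans hj.symm)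

/-- The agents of `L` satisfied by `μ` using only agents in `A` and rooms in `B` number at most
six times the triples the dictatorship creates from `A` and `B`. -/
theorem card_satisfied_le_six_mul_length [Fintype N] (μ : RMatching N R) (L : List N)
    (A : Finset N) (B : Finset R) :
    (Finset.univ.filter fun i => i ∈ L ∧ i ∈ A ∧ μ.partner i ∈ A ∧ μ.room i ∈ B ∧
      v i (μ.partner i) = 1 ∧ vh i (μ.room i) = 1).card ≤
      6 * (ltsdRun sel v vh L A B).length := by
  induction L generalizing A B with
  | nil => simp
  | cons a L ih =>
    by_cases h : LTCanChoose v vh a A B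
    · rw [ltsdRun_cons_of_canChoose h, List.length_cons]
      set j := (ltsdTriple sel v vh a A B).2.1
      set r := (ltsdTriple sel v vh a A B).2.2
      have hsub : (Finset.univ.filter fun i => i ∈ a :: L ∧ i ∈ A ∧ μ.partner i ∈ A ∧
          μ.room i ∈ B ∧ v i (μ.partner i) = 1 ∧ vh i (μ.room i) = 1) ⊆
          (Finset.univ.filter fun i => i ∈ L ∧ i ∈ (A.erase a).erase j ∧
            μ.partner i ∈ (A.erase a).erase j ∧ μ.room i ∈ B.erase r ∧
            v i (μ.partner i) = 1 ∧ vh i (μ.room i) = 1) ∪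
          (({a, μ.partner a, j, μ.partner j} : Finset N) ∪
            Finset.univ.filter fun i => μ.room i = r) := by
        intro i hi
        have hp : ∀ b, μ.partner i = b → i = μ.partner b := fun b hb => by
          rw [← hb, μ.partner_invol]
        simp only [Finset.mem_union, Finset.mem_filter, Finset.mem_univ, true_and,
          Finset.mem_erase, Finset.mem_insert, Finset.mem_singleton, List.mem_cons] at hi ⊢
        have := hp a
        have := hp j
        tauto
      have h₁ := (Finset.card_le_card hsub).trans (Finset.card_union_le _ _)
      have h₂ := Finset.card_union_le ({a, μ.partner a, j, μ.partner j} : Finset N)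
        (Finset.univ.filter fun i => μ.room i = r)
      have h₃ : ({a, μ.partner a, j, μ.partner j} : Finset N).card ≤ 4 := Finset.card_le_four
      have h₄ := card_filter_room_eq_le_two μ r
      have h₅ := ih ((A.erase a).erase j) (B.erase r)
      omega
    · rw [ltsdRun_cons_of_not_canChoose h]
      refine (Finset.card_le_card fun i hi => ?_).trans (ih A B)
      simp only [Finset.mem_filter, Finset.mem_univ, true_and, List.mem_cons] at hi ⊢
      obtain ⟨rfl | hL, hi⟩ := hi
      · exact absurd ⟨hi.1, _, Finset.mem_erase.2 ⟨μ.partner_ne i, hi.2.1⟩, _, hi.2.2⟩ h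
      · exact ⟨hL, hi⟩

section Output

variable [Fintype N] [Fintype R] {comp : Finset N → Finset R → List (N × N × R)}

theorem mem_leftA {ts : List (N × N × R)} {a : N} :
    a ∈ leftA ts ↔ ∀ t ∈ ts, a ≠ t.1 ∧ a ≠ t.2.1 := by
  simp [leftA]

theorem mem_leftR {ts : List (N × N × R)} {r : R} : r ∈ leftR ts ↔ ∀ t ∈ ts, r ≠ t.2.2 := by
  simp [leftR]

theorem ltsdFrom_nil (A : Finset N) (B : Finset R) :
    ltsdFrom sel comp v vh [] A B = comp A B := by
  simp [ltsdFrom, ltsdRun, leftA, leftR]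

theorem ltsdFrom_cons_of_canChoose {a : N} {A : Finset N} {B : Finset R}
    (h : LTCanChoose v vh a A B) (L : List N) :
    ltsdFrom sel comp v vh (a :: L) A B =
      ltsdTriple sel v vh a A B ::
        ltsdFrom sel comp v vh L ((A.erase a).erase (ltsdTriple sel v vh a A B).2.1)
          (B.erase (ltsdTriple sel v vh a A B).2.2) := by
  rw [ltsdFrom, ltsdRun_cons_of_canChoose h, ltsdFrom, List.cons_append]
  congr 3
  · ext b
    simp only [Finset.mem_inter, mem_leftA, List.forall_mem_cons, Finset.mem_erase,
      ltsdTriple_fst]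
    tauto
  · ext b
    simp only [Finset.mem_inter, mem_leftR, List.forall_mem_cons, Finset.mem_erase]
    tauto

theorem ltsdFrom_cons_of_not_canChoose {a : N} {A : Finset N} {B : Finset R}
    (h : ¬LTCanChoose v vh a A B) (L : List N) :
    ltsdFrom sel comp v vh (a :: L) A B = ltsdFrom sel comp v vh L A B := by
  rw [ltsdFrom, ltsdRun_cons_of_not_canChoose h, ltsdFrom]

theorem ltsdFrom_univ (L : List N) :
    ltsdFrom sel comp v vh L Finset.univ Finset.univ = ltsdOutput sel comp v vh L := by
  simp only [ltsdFrom, ltsdOutput, Finset.univ_inter]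

theorem ValidSel.isTripleList_ltsdFrom (hsel : ValidSel sel)
    (hcomp : ∀ A B, A.card = 2 * B.card → IsTripleList A B (comp A B)) (L : List N)
    {A : Finset N} {B : Finset R} (hc : A.card = 2 * B.card) :
    IsTripleList A B (ltsdFrom sel comp v vh L A B) := by
  induction L generalizing A B with
  | nil => rw [ltsdFrom_nil]; exact hcomp A B hc
  | cons a L ih =>
    by_cases h : LTCanChoose v vh a A B
    · rw [ltsdFrom_cons_of_canChoose h]
      have hL := ih (hsel.card_erase h hc)
      obtain ⟨h₁, h₂, -⟩ := hsel.triple_mem h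
      refine ⟨List.forall_mem_cons.2 ⟨⟨h.1, Finset.mem_of_mem_erase h₁, h₂,
        (Finset.ne_of_mem_erase h₁).symm⟩, fun t ht => ?_⟩,
        List.pairwise_cons.2 ⟨fun t ht => ?_, hL.disj⟩⟩
      all_goals
        have ht' := hL.mem t ht
        simp only [Finset.mem_erase] at ht'
      · tauto
      · exact ⟨ht'.1.2.1.symm, ht'.2.1.2.1.symm, ht'.1.1.symm, ht'.2.1.1.symm, ht'.2.2.1.1.symm⟩
    · rw [ltsdFrom_cons_of_not_canChoose h]
      exact ih hc

theorem ValidSel.listUtilL_update_le (hsel : ValidSel sel)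
    (hcomp : ∀ A B, A.card = 2 * B.card → IsTripleList A B (comp A B)) (hbin : Binary v vh)
    (i : N) (vi' : N → ℝ) (vhi' : R → ℝ) (L : List N) {A : Finset N} {B : Finset R}
    (hc : A.card = 2 * B.card) :
    listUtilL v vh i
        (ltsdFrom sel comp (Function.update v i vi') (Function.update vh i vhi') L A B) ≤
      listUtilL v vh i (ltsdFrom sel comp v vh L A B) := by
  induction L generalizing A B with
  | nil => rw [ltsdFrom_nil, ltsdFrom_nil]
  | cons a L ih =>
    have hlist := hsel.isTripleList_ltsdFrom (v := Function.update v i vi')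
      (vh := Function.update vh i vhi') hcomp (a :: L) hc
    obtain rfl | ha := eq_or_ne a i
    · by_cases h : LTCanChoose v vh a A B
      · refine (hbin.listUtilL_le_one a hlist.disj).trans ?_
        obtain ⟨-, -, h₁, h₂⟩ := hsel.triple_mem h
        rw [ltsdFrom_cons_of_canChoose h, listUtilL_cons, if_pos ltsdTriple_fst.symm, h₁, h₂,
          min_self]
        exact le_add_of_nonneg_right (hbin.listUtilL_nonneg _ _)
      · refine le_of_eq_of_le (listUtilL_eq_zero fun t ht => ?_) (hbin.listUtilL_nonneg _ _)
        obtain ⟨h₁, h₂, h₃, h₄⟩ := hlist.mem t ht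
        exact ⟨fun e => hbin.min_eq_zero fun hv => h ⟨e ▸ h₁, _,
            Finset.mem_erase.2 ⟨e ▸ h₄.symm, h₂⟩, _, h₃, hv⟩,
          fun e => hbin.min_eq_zero fun hv => h ⟨e ▸ h₂, _,
            Finset.mem_erase.2 ⟨e ▸ h₄, h₁⟩, _, h₃, hv⟩⟩
    · have hcan : LTCanChoose (Function.update v i vi') (Function.update vh i vhi') a A B ↔
          LTCanChoose v vh a A B := by
        simp only [LTCanChoose, Function.update_of_ne ha]
      have htri : ltsdTriple sel (Function.update v i vi') (Function.update vh i vhi') a A B =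
          ltsdTriple sel v vh a A B := by
        simp only [ltsdTriple, Function.update_of_ne ha]
      by_cases h : LTCanChoose v vh a A B
      · rw [ltsdFrom_cons_of_canChoose h, ltsdFrom_cons_of_canChoose (hcan.2 h), htri,
          listUtilL_cons, listUtilL_cons]
        exact add_le_add le_rfl (ih (hsel.card_erase h hc))
      · rw [ltsdFrom_cons_of_not_canChoose h, ltsdFrom_cons_of_not_canChoose (mt hcan.1 h)]
        exact ih hc

theorem ValidSel.USWL_le_six_mul (hsel : ValidSel sel) (hbin : Binary v vh) {L : List N}
    (hfull : ∀ a, a ∈ L) (μ : RMatching N R) :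
    USWL v vh μ ≤ 6 * ∑ a, listUtilL v vh a (ltsdOutput sel comp v vh L) := by
  have h₁ := card_satisfied_le_six_mul_length (v := v) (vh := vh) (sel := sel) μ L
    Finset.univ Finset.univ
  simp only [hfull, Finset.mem_univ, true_and] at h₁
  have h₂ := hbin.length_le_sum_listUtilL
    (hsel.run_values (v := v) (vh := vh) L Finset.univ Finset.univ)
  have h₃ : ∑ a, listUtilL v vh a (ltsdRun sel v vh L Finset.univ Finset.univ) ≤
      ∑ a, listUtilL v vh a (ltsdOutput sel comp v vh L) := by
    refine Finset.sum_le_sum fun a _ => ?_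
    rw [ltsdOutput, listUtilL_append]
    exact le_add_of_nonneg_right (hbin.listUtilL_nonneg _ _)
  rw [hbin.USWL_eq_card]
  refine (Nat.cast_le.2 h₁).trans ?_
  rw [Nat.cast_mul, Nat.cast_ofNat]
  linarith

end Output

end Run

end LTSD

/-- Under binary Leontief utilities, the L/T Serial Dictatorship mechanism (with a
valid selection rule `sel` depending only on the reported valuations of the selecting
agent and the remaining agents and rooms, and a valid report-independent completion rule
`comp`) is strategyproof and achieves at least one sixth of the maximum social welfare. -/
theorem LT_serial_dictatorship_SP_and_one_sixth
    {N R : Type*} [Fintype N] [Fintype R] [DecidableEq N] [DecidableEq R] (n : ℕ)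
    (hN : Fintype.card N = 2 * n) (hR : Fintype.card R = n)
    (L : List N) (hnd : L.Nodup) (hfull : ∀ a : N, a ∈ L)
    (sel : N → (N → ℝ) → (R → ℝ) → Finset N → Finset R → N × R)
    (hsel : ∀ (a : N) (va : N → ℝ) (vha : R → ℝ) (A : Finset N) (B : Finset R),
      (∃ j ∈ A, ∃ r ∈ B, va j = 1 ∧ vha r = 1) →
      (sel a va vha A B).1 ∈ A ∧ (sel a va vha A B).2 ∈ B ∧
        va (sel a va vha A B).1 = 1 ∧ vha (sel a va vha A B).2 = 1)
    (comp : Finset N → Finset R → List (N × N × R))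
    (hcomp : ∀ (A : Finset N) (B : Finset R), A.card = 2 * B.card →
      (∀ t ∈ comp A B, t.1 ∈ A ∧ t.2.1 ∈ A ∧ t.2.2 ∈ B ∧ t.1 ≠ t.2.1) ∧
      (comp A B).Pairwise TripleDisj ∧
      (∀ a ∈ A, ∃ t ∈ comp A B, a = t.1 ∨ a = t.2.1) ∧
      (∀ r ∈ B, ∃ t ∈ comp A B, r = t.2.2))
    (v : N → N → ℝ) (vh : N → R → ℝ) (hbin : Binary v vh) :
    (∀ (i : N) (vi' : N → ℝ) (vhi' : R → ℝ),
      (∀ j, vi' j = 0 ∨ vi' j = 1) → (∀ r, vhi' r = 0 ∨ vhi' r = 1) →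
      listUtilL v vh i
          (ltsdOutput sel comp (Function.update v i vi') (Function.update vh i vhi') L) ≤
        listUtilL v vh i (ltsdOutput sel comp v vh L)) ∧
    (∀ μ' : RMatching N R,
      (1 / 6 : ℝ) * USWL v vh μ' ≤ ∑ a : N, listUtilL v vh a (ltsdOutput sel comp v vh L)) := by
  have hsel' : ValidSel sel := hsel
  refine ⟨fun i vi' vhi' _ _ => ?_, fun μ => ?_⟩
  · rw [← ltsdFrom_univ, ← ltsdFrom_univ]
    refine hsel'.listUtilL_update_le (fun A B hc => ⟨(hcomp A B hc).1, (hcomp A B hc).2.1⟩)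
      hbin i vi' vhi' L ?_
    rw [Finset.card_univ, Finset.card_univ, hN, hR]
  · linarith [hsel'.USWL_le_six_mul (comp := comp) hbin hfull μ]
end

section
/- Under binary valuations with symmetric compatibility valuations and additive utilities, the Welfare-Prioritized Serial Dictatorship mechanism achieves at least one sixth of the maximum social welfare: for every binary profile with v_i(j) = v_j(i) for all distinct agents i, j, the output matching μ satisfies USW(μ) ≥ (1/6) · max_{μ'} USW(μ'). -/
open scoped BigOperators
open scoped Classical

/-- The true additive utility of agent `a` in a list of triples. -/
noncomputable def listUtilA {N R : Type*} [DecidableEq N] (v : N → N → ℝ)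
    (vh : N → R → ℝ) (a : N) (ts : List (N × N × R)) : ℝ :=
  (ts.map (fun t =>
    if a = t.1 then v a t.2.1 + vh a t.2.2
    else if a = t.2.1 then v a t.1 + vh a t.2.2
    else 0)).sum

/-- The dictatorship phase of the Welfare-Prioritized Serial Dictatorship mechanism:
agents are called in the priority order; a still-unmatched called agent `a` with positive
reported value for some remaining (agent, room) pair is matched into the triple given by
its selection rule `sel` (a function of its own reported valuations and the remaining
agents and rooms only); agents with zero value for everything remaining are set aside. -/
noncomputable def wpsdRun {N R : Type*} [DecidableEq N] [DecidableEq R]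
    (sel : N → (N → ℝ) → (R → ℝ) → Finset N → Finset R → N × R)
    (v : N → N → ℝ) (vh : N → R → ℝ) :
    List N → Finset N → Finset R → List (N × N × R)
  | [], _, _ => []
  | a :: L, A, B =>
    if a ∈ A ∧ ∃ j ∈ A.erase a, ∃ r ∈ B, 0 < v a j + vh a r then
      (a, (sel a (v a) (vh a) (A.erase a) B).1, (sel a (v a) (vh a) (A.erase a) B).2) ::
        wpsdRun sel v vh L ((A.erase a).erase (sel a (v a) (vh a) (A.erase a) B).1)
          (B.erase (sel a (v a) (vh a) (A.erase a) B).2)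
    else wpsdRun sel v vh L A B

/-- The full output of the Welfare-Prioritized Serial Dictatorship mechanism: the
dictatorship phase followed by the (report-independent) completion rule `comp` on the
leftover agents and rooms. -/
noncomputable def wpsdOutput {N R : Type*} [Fintype N] [Fintype R]
    [DecidableEq N] [DecidableEq R]
    (sel : N → (N → ℝ) → (R → ℝ) → Finset N → Finset R → N × R)
    (comp : Finset N → Finset R → List (N × N × R))
    (v : N → N → ℝ) (vh : N → R → ℝ) (L : List N) : List (N × N × R) :=
  wpsdRun sel v vh L Finset.univ Finset.univ ++
    comp (leftA (wpsdRun sel v vh L Finset.univ Finset.univ))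
      (leftR (wpsdRun sel v vh L Finset.univ Finset.univ))

/-- The welfare contributed to `μ` by agent `a` through compatibility with its partner, counted
only when both agents lie in `A`. -/
noncomputable def compatWithin {N R : Type*} (v : N → N → ℝ) (μ : RMatching N R) (A : Finset N)
    (a : N) : ℝ :=
  if a ∈ A ∧ μ.partner a ∈ A then v a (μ.partner a) else 0

/-- The welfare contributed to `μ` by agent `a` through its room, counted only when the agent lies
in `A` and the room in `B`. -/
noncomputable def roomWithin {N R : Type*} (vh : N → R → ℝ) (μ : RMatching N R) (A : Finset N)
    (B : Finset R) (a : N) : ℝ :=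
  if a ∈ A ∧ μ.room a ∈ B then vh a (μ.room a) else 0

section Welfare

variable {N R : Type*} {v : N → N → ℝ} {vh : N → R → ℝ}

theorem Binary.compat_nonneg (h : Binary v vh) (i j : N) : 0 ≤ v i j := by
  rcases h.1 i j with h | h <;> simp [h]

theorem Binary.compat_le_one (h : Binary v vh) (i j : N) : v i j ≤ 1 := by
  rcases h.1 i j with h | h <;> simp [h]

theorem Binary.room_nonneg (h : Binary v vh) (i : N) (r : R) : 0 ≤ vh i r := by
  rcases h.2 i r with h | h <;> simp [h]

theorem Binary.room_le_one (h : Binary v vh) (i : N) (r : R) : vh i r ≤ 1 := by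
  rcases h.2 i r with h | h <;> simp [h]

theorem compatWithin_nonneg (h : Binary v vh) (μ : RMatching N R) (A : Finset N) (a : N) :
    0 ≤ compatWithin v μ A a := by
  unfold compatWithin
  split_ifs
  exacts [h.compat_nonneg _ _, le_rfl]

theorem compatWithin_le_one (h : Binary v vh) (μ : RMatching N R) (A : Finset N) (a : N) :
    compatWithin v μ A a ≤ 1 := by
  unfold compatWithin
  split_ifs
  exacts [h.compat_le_one _ _, zero_le_one]

theorem compatWithin_partner (hsym : ∀ i j, v i j = v j i) (μ : RMatching N R) (A : Finset N)
    (a : N) : compatWithin v μ A (μ.partner a) = compatWithin v μ A a := by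
  simp only [compatWithin, μ.partner_invol, and_comm, hsym (μ.partner a) a]

theorem roomWithin_nonneg (h : Binary v vh) (μ : RMatching N R) (A : Finset N) (B : Finset R)
    (a : N) : 0 ≤ roomWithin vh μ A B a := by
  unfold roomWithin
  split_ifs
  exacts [h.room_nonneg _ _, le_rfl]

theorem roomWithin_le_one (h : Binary v vh) (μ : RMatching N R) (A : Finset N) (B : Finset R)
    (a : N) : roomWithin vh μ A B a ≤ 1 := by
  unfold roomWithin
  split_ifs
  exacts [h.room_le_one _ _, zero_le_one]

variable [DecidableEq N]

theorem listUtilA_nonneg (h : Binary v vh) (a : N) (ts : List (N × N × R)) :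
    0 ≤ listUtilA v vh a ts := by
  refine List.sum_nonneg fun x hx => ?_
  obtain ⟨t, -, rfl⟩ := List.mem_map.1 hx
  have h1 := h.compat_nonneg a t.1
  have h2 := h.compat_nonneg a t.2.1
  have h3 := h.room_nonneg a t.2.2
  split_ifs <;> linarith

variable [Fintype N]

/-- Removing two agents destroys at most the compatibility welfare of their two pairs. -/
theorem sum_compatWithin_le_erase (h : Binary v vh) (hsym : ∀ i j, v i j = v j i)
    (μ : RMatching N R) (A : Finset N) (i j : N) :
    ∑ a, compatWithin v μ A a ≤ ∑ a, compatWithin v μ ((A.erase i).erase j) a +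
      2 * compatWithin v μ A i + 2 * compatWithin v μ A j := by
  have key : ∀ a, compatWithin v μ A a ≤ compatWithin v μ ((A.erase i).erase j) a +
      (if a = i then compatWithin v μ A a else 0) + (if a = j then compatWithin v μ A a else 0) +
      (if a = μ.partner i then compatWithin v μ A a else 0) +
      (if a = μ.partner j then compatWithin v μ A a else 0) := by
    intro a
    have h0 := compatWithin_nonneg h μ A a
    have h1 := compatWithin_nonneg h μ ((A.erase i).erase j) a
    by_cases hi : a = i
    · simp only [if_pos hi]; split_ifs <;> linarith
    by_cases hj : a = j
    · simp only [if_pos hj]; split_ifs <;> linarith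
    by_cases hpi : a = μ.partner i
    · simp only [if_pos hpi]; split_ifs <;> linarith
    by_cases hpj : a = μ.partner j
    · simp only [if_pos hpj]; split_ifs <;> linarith
    have hpi' : μ.partner a ≠ i := fun e => hpi (by rw [← e, μ.partner_invol])
    have hpj' : μ.partner a ≠ j := fun e => hpj (by rw [← e, μ.partner_invol])
    simp [compatWithin, hi, hj, hpi, hpj, hpi', hpj']
    split_ifs <;> rfl
  refine (Finset.sum_le_sum fun a _ => key a).trans (le_of_eq ?_)
  simp only [Finset.sum_add_distrib, Finset.sum_ite_eq', Finset.mem_univ, if_true,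
    compatWithin_partner hsym]
  ring

theorem sum_listUtilA_cons {i j : N} (hij : j ≠ i) (r : R) (ts : List (N × N × R)) :
    ∑ a, listUtilA v vh a ((i, j, r) :: ts) =
      v i j + vh i r + (v j i + vh j r) + ∑ a, listUtilA v vh a ts := by
  have key : ∀ a, listUtilA v vh a ((i, j, r) :: ts) =
      (if a = i then v i j + vh i r else 0) + (if a = j then v j i + vh j r else 0) +
        listUtilA v vh a ts := by
    intro a
    simp only [listUtilA, List.map_cons, List.sum_cons]
    congr 1
    by_cases hi : a = i
    · subst hi; simp [hij.symm]
    · by_cases hj : a = j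
      · subst hj; simp [hi]
      · simp [hi, hj]
  simp [key, Finset.sum_add_distrib]

variable [DecidableEq R]

theorem RMatching.card_room_fiber_le_two (μ : RMatching N R) (r : R) :
    (Finset.univ.filter fun a => μ.room a = r).card ≤ 2 := by
  rcases (Finset.univ.filter fun a => μ.room a = r).eq_empty_or_nonempty with h | ⟨b, hb⟩
  · simp [h]
  · refine (Finset.card_le_card (t := {b, μ.partner b}) fun a ha => ?_).trans Finset.card_le_two
    simp only [Finset.mem_filter, Finset.mem_univ, true_and] at ha hb
    simpa using μ.room_pair b a (hb.trans ha.symm)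

/-- Removing two agents and a room destroys at most four units of room welfare. -/
theorem sum_roomWithin_le_erase (h : Binary v vh) (μ : RMatching N R) (A : Finset N)
    (B : Finset R) (i j : N) (r : R) :
    ∑ a, roomWithin vh μ A B a ≤
      ∑ a, roomWithin vh μ ((A.erase i).erase j) (B.erase r) a + 4 := by
  have key : ∀ a, roomWithin vh μ A B a ≤
      roomWithin vh μ ((A.erase i).erase j) (B.erase r) a +
      (if a = i then 1 else 0) + (if a = j then 1 else 0) +
      (if μ.room a = r then 1 else 0) := by
    intro a
    have h0 := roomWithin_le_one h μ A B a
    have h1 := roomWithin_nonneg h μ ((A.erase i).erase j) (B.erase r) a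
    by_cases hi : a = i
    · simp only [if_pos hi]; split_ifs <;> linarith
    by_cases hj : a = j
    · simp only [if_pos hj]; split_ifs <;> linarith
    by_cases hr : μ.room a = r
    · simp only [if_pos hr]; split_ifs <;> linarith
    simp [roomWithin, hi, hj, hr]
    split_ifs <;> rfl
  refine (Finset.sum_le_sum fun a _ => key a).trans ?_
  have hc : ((Finset.univ.filter fun a => μ.room a = r).card : ℝ) ≤ 2 := by
    exact_mod_cast μ.card_room_fiber_le_two r
  simp only [Finset.sum_add_distrib, Finset.sum_ite_eq', Finset.mem_univ, if_true,
    Finset.sum_boole]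
  linarith

/-- The part of the welfare of `μ` supported on the remaining agents `A` and rooms `B` is at most
six times the welfare of the dictatorship phase run from `A` and `B`, provided every remaining
agent who is no longer to be called has no positive value left. -/
theorem sum_within_le_six_mul_wpsdRun
    {sel : N → (N → ℝ) → (R → ℝ) → Finset N → Finset R → N × R}
    (hsel : ∀ (a : N) (va : N → ℝ) (vha : R → ℝ) (A : Finset N) (B : Finset R),
      (∃ j ∈ A, ∃ r ∈ B, 0 < va j + vha r) →
      (sel a va vha A B).1 ∈ A ∧ (sel a va vha A B).2 ∈ B ∧
        (∀ j ∈ A, va j ≤ va (sel a va vha A B).1) ∧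
        (∀ r ∈ B, vha r ≤ vha (sel a va vha A B).2))
    (h : Binary v vh) (hsym : ∀ i j, v i j = v j i) (μ : RMatching N R)
    (L : List N) (A : Finset N) (B : Finset R) (hcard : A.card = 2 * B.card)
    (hdead : ∀ a ∈ A, a ∉ L → ¬ ∃ j ∈ A.erase a, ∃ r ∈ B, 0 < v a j + vh a r) :
    ∑ a, compatWithin v μ A a + ∑ a, roomWithin vh μ A B a ≤
      6 * ∑ a, listUtilA v vh a (wpsdRun sel v vh L A B) := by
  induction L generalizing A B with
  | nil =>
    have hC : ∀ a, compatWithin v μ A a ≤ 0 := by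
      intro a
      unfold compatWithin
      split_ifs with ha
      · by_contra! hpos
        obtain ⟨r, hr⟩ : B.Nonempty := by
          have := Finset.card_pos.2 ⟨a, ha.1⟩
          exact Finset.card_pos.1 (by omega)
        exact hdead a ha.1 (by simp) ⟨μ.partner a,
          Finset.mem_erase.2 ⟨μ.partner_ne a, ha.2⟩, r, hr,
          add_pos_of_pos_of_nonneg hpos (h.room_nonneg _ _)⟩
      · exact le_rfl
    have hD : ∀ a, roomWithin vh μ A B a ≤ 0 := by
      intro a
      unfold roomWithin
      split_ifs with ha
      · by_contra! hpos
        obtain ⟨j, hj⟩ : (A.erase a).Nonempty := by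
          have := Finset.card_erase_of_mem ha.1
          have := Finset.card_pos.2 ⟨_, ha.2⟩
          exact Finset.card_pos.1 (by omega)
        exact hdead a ha.1 (by simp) ⟨j, hj, _, ha.2,
          add_pos_of_nonneg_of_pos (h.compat_nonneg _ _) hpos⟩
      · exact le_rfl
    have h1 := Finset.sum_nonpos fun a (_ : a ∈ Finset.univ) => hC a
    have h2 := Finset.sum_nonpos fun a (_ : a ∈ Finset.univ) => hD a
    simp only [wpsdRun, listUtilA, List.map_nil, List.sum_nil, Finset.sum_const_zero, mul_zero]
    linarith
  | cons i L ih =>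
    rw [wpsdRun]
    split_ifs with hi
    · obtain ⟨hiA, hex⟩ := hi
      obtain ⟨hj, hr, hjmax, hrmax⟩ := hsel i (v i) (vh i) (A.erase i) B hex
      generalize (sel i (v i) (vh i) (A.erase i) B).1 = j at *
      generalize (sel i (v i) (vh i) (A.erase i) B).2 = r at *
      have hji : j ≠ i := Finset.ne_of_mem_erase hj
      have hrest := ih ((A.erase i).erase j) (B.erase r)
        (by
          rw [Finset.card_erase_of_mem hj, Finset.card_erase_of_mem hiA,
            Finset.card_erase_of_mem hr]
          omega)
        (by
          rintro a ha haL ⟨j', hj', r', hr', hpos⟩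
          simp only [Finset.mem_erase] at ha hj' hr'
          exact hdead a ha.2.2 (by simp [ha.2.1, haL])
            ⟨j', by simp [hj'], r', hr'.2, hpos⟩)
      rw [sum_listUtilA_cons hji]
      have hC := sum_compatWithin_le_erase h hsym μ A i j
      have hD := sum_roomWithin_le_erase h μ A B i j r
      have hCi := compatWithin_le_one h μ A i
      have hCj := compatWithin_le_one h μ A j
      have hvr := h.room_nonneg i r
      have hvr' := h.room_nonneg j r
      rw [hsym j i]
      rcases h.1 i j with hv | hv
      · have hCi' : compatWithin v μ A i ≤ 0 := by
          unfold compatWithin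
          split_ifs with hp
          · exact hv ▸ hjmax _ (Finset.mem_erase.2 ⟨μ.partner_ne i, hp.2⟩)
          · exact le_rfl
        have hri : vh i r = 1 := by
          obtain ⟨j', hj', r', hr', hpos⟩ := hex
          have h1 := hjmax j' hj'
          have h2 := hrmax r' hr'
          rcases h.2 i r with h3 | h3
          · linarith
          · exact h3
        linarith
      · linarith
    · refine ih A B hcard fun a ha haL => ?_
      by_cases hai : a = i
      · subst hai
        exact fun hex => hi ⟨ha, hex⟩
      · exact hdead a ha (by simp [hai, haL])

end Welfare

/-- Under binary additive utilities with symmetric compatibility valuations, the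
Welfare-Prioritized Serial Dictatorship mechanism (with a valid selection rule `sel` and a
valid report-independent completion rule `comp`) achieves at least one sixth of the
maximum social welfare. -/
theorem WPSD_symmetric_one_sixth
    {N R : Type*} [Fintype N] [Fintype R] [DecidableEq N] [DecidableEq R] (n : ℕ)
    (hN : Fintype.card N = 2 * n) (hR : Fintype.card R = n)
    (L : List N) (hnd : L.Nodup) (hfull : ∀ a : N, a ∈ L)
    (sel : N → (N → ℝ) → (R → ℝ) → Finset N → Finset R → N × R)
    (hsel : ∀ (a : N) (va : N → ℝ) (vha : R → ℝ) (A : Finset N) (B : Finset R),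
      (∃ j ∈ A, ∃ r ∈ B, 0 < va j + vha r) →
      (sel a va vha A B).1 ∈ A ∧ (sel a va vha A B).2 ∈ B ∧
        (∀ j ∈ A, va j ≤ va (sel a va vha A B).1) ∧
        (∀ r ∈ B, vha r ≤ vha (sel a va vha A B).2))
    (comp : Finset N → Finset R → List (N × N × R))
    (hcomp : ∀ (A : Finset N) (B : Finset R), A.card = 2 * B.card →
      (∀ t ∈ comp A B, t.1 ∈ A ∧ t.2.1 ∈ A ∧ t.2.2 ∈ B ∧ t.1 ≠ t.2.1) ∧
      (comp A B).Pairwise TripleDisj ∧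
      (∀ a ∈ A, ∃ t ∈ comp A B, a = t.1 ∨ a = t.2.1) ∧
      (∀ r ∈ B, ∃ t ∈ comp A B, r = t.2.2))
    (v : N → N → ℝ) (vh : N → R → ℝ) (hbin : Binary v vh)
    (hsym : ∀ i j : N, v i j = v j i) :
    ∀ μ' : RMatching N R,
      (1 / 6 : ℝ) * USWA v vh μ' ≤ ∑ a : N, listUtilA v vh a (wpsdOutput sel comp v vh L) := by
  intro μ
  have hrun := sum_within_le_six_mul_wpsdRun hsel hbin hsym μ L Finset.univ Finset.univ
    (by rw [Finset.card_univ, Finset.card_univ, hN, hR]) (fun a _ ha => (ha (hfull a)).elim)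
  have hμ : USWA v vh μ = ∑ a, compatWithin v μ Finset.univ a +
      ∑ a, roomWithin vh μ Finset.univ Finset.univ a := by
    simp [USWA, uAdditive, compatWithin, roomWithin, Finset.sum_add_distrib]
  have hout : ∑ a, listUtilA v vh a (wpsdRun sel v vh L Finset.univ Finset.univ) ≤
      ∑ a, listUtilA v vh a (wpsdOutput sel comp v vh L) := by
    refine Finset.sum_le_sum fun a _ => ?_
    have := listUtilA_nonneg hbin a
      (comp (leftA (wpsdRun sel v vh L Finset.univ Finset.univ))
        (leftR (wpsdRun sel v vh L Finset.univ Finset.univ)))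
    simp only [wpsdOutput, listUtilA, List.map_append, List.sum_append] at this ⊢
    linarith
  linarith
end

section
/- A naive maximal matching built from the preference graph gives no welfare guarantee under Leontief utilities: there exists a roommate matching instance with 6 agents and 3 rooms and binary valuations such that, under Leontief utilities, the maximum social welfare over all roommate matchings equals 6, yet there exist distinct agents i, j and a room r with v_i(j) = 1 and v̂_j(r) = 1 (so the triple (i, j, r) is formed from two preference-graph edges and may be selected by the naive procedure) such that every complete roommate matching containing the triple (i, j, r) has social welfare 0. -/
open scoped BigOperators

/-- The roommate matching `{0,1}, {2,3}, {4,5}` with rooms `0, 1, 2`. -/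
def consecutivePairs : RMatching (Fin 6) (Fin 3) where
  partner := ![1, 0, 3, 2, 5, 4]
  room := ![0, 0, 1, 1, 2, 2]
  partner_ne := by decide
  partner_invol := by decide
  room_partner := by decide
  room_pair := by decide

/-- Each agent likes the roommate from `consecutivePairs`; agent `0` also likes agent `2`. -/
def roommateVal (i j : Fin 6) : ℝ :=
  if j = consecutivePairs.partner i ∨ (i = 0 ∧ j = 2) then 1 else 0

/-- Each agent likes the room from `consecutivePairs`; agent `2` also likes room `2`. -/
def roomVal (i : Fin 6) (r : Fin 3) : ℝ :=
  if r = consecutivePairs.room i ∨ (i = 2 ∧ r = 2) then 1 else 0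

lemma binary_roommateVal_roomVal : Binary roommateVal roomVal := by
  refine ⟨fun i j => ?_, fun i r => ?_⟩
  · unfold roommateVal; split_ifs <;> simp
  · unfold roomVal; split_ifs <;> simp

/-- Under binary valuations the welfare is at most the number of agents. -/
lemma Binary.USWL_le_card {N R : Type*} [Fintype N] {v : N → N → ℝ} {vh : N → R → ℝ}
    (h : Binary v vh) (μ : RMatching N R) : USWL v vh μ ≤ Fintype.card N := by
  have hu : ∀ i ∈ Finset.univ, uLeontief v vh μ i ≤ 1 := fun i _ =>
    (min_le_left _ _).trans (by rcases h.1 i (μ.partner i) with h | h <;> simp [h])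
  simpa [USWL] using Finset.sum_le_card_nsmul _ _ _ hu

/-- A binary Leontief utility vanishes unless the agent likes both roommate and room. -/
lemma Binary.uLeontief_eq_zero {N R : Type*} {v : N → N → ℝ} {vh : N → R → ℝ}
    (h : Binary v vh) {μ : RMatching N R} {i : N}
    (hi : v i (μ.partner i) = 0 ∨ vh i (μ.room i) = 0) : uLeontief v vh μ i = 0 := by
  unfold uLeontief
  rcases h.1 i (μ.partner i) with h₁ | h₁ <;> rcases h.2 i (μ.room i) with h₂ | h₂ <;>
    simp_all

lemma USWL_consecutivePairs : USWL roommateVal roomVal consecutivePairs = 6 := by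
  simp [USWL, uLeontief, roommateVal, roomVal]

lemma USWL_eq_zero_of_partner_of_room {μ : RMatching (Fin 6) (Fin 3)}
    (hp : μ.partner 0 = 2) (hr : μ.room 0 = 2) : USWL roommateVal roomVal μ = 0 := by
  have hp' : μ.partner 2 = 0 := by rw [← hp, μ.partner_invol]
  have h₁ : μ.partner 1 ≠ 0 := fun h => by
    have := μ.partner_invol 1
    rw [h, hp] at this
    exact absurd this (by decide)
  have h₃ : μ.partner 3 ≠ 2 := fun h => by
    have := μ.partner_invol 3
    rw [h, hp'] at this
    exact absurd this (by decide)
  have hroom : ∀ k, k ≠ 0 → k ≠ 2 → μ.room k ≠ 2 := fun k hk₀ hk₂ h => by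
    rcases μ.room_pair 0 k (hr.trans h.symm) with h | h
    · exact hk₀ h
    · exact hk₂ (h.trans hp)
  have h₄ := hroom 4 (by decide) (by decide)
  have h₅ := hroom 5 (by decide) (by decide)
  refine Finset.sum_eq_zero fun k _ => binary_roommateVal_roomVal.uLeontief_eq_zero ?_
  fin_cases k <;> simp [roommateVal, roomVal, consecutivePairs, *]

/-- A naive maximal matching built from preference-graph edges gives no welfare guarantee
under binary Leontief utilities: there is a binary instance with 6 agents and 3 rooms of
maximum social welfare 6 in which some triple `(i, j, r)` formed from the two
preference-graph edges `v i j = 1` and `vh j r = 1` is such that every complete roommate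
matching containing it has social welfare 0. -/
theorem naive_maximal_unbounded_leontief :
    ∃ (v : Fin 6 → Fin 6 → ℝ) (vh : Fin 6 → Fin 3 → ℝ),
      Binary v vh ∧
      (∃ μ : RMatching (Fin 6) (Fin 3), USWL v vh μ = 6) ∧
      (∀ μ : RMatching (Fin 6) (Fin 3), USWL v vh μ ≤ 6) ∧
      ∃ (i j : Fin 6) (r : Fin 3), i ≠ j ∧ v i j = 1 ∧ vh j r = 1 ∧
        ∀ μ : RMatching (Fin 6) (Fin 3),
          μ.partner i = j → μ.room i = r → USWL v vh μ = 0 := by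
  exact ⟨roommateVal, roomVal, binary_roommateVal_roomVal,
    ⟨consecutivePairs, USWL_consecutivePairs⟩,
    fun μ => by simpa using binary_roommateVal_roomVal.USWL_le_card μ,
    0, 2, 2, by decide, by simp [roommateVal], by simp [roomVal],
    fun _ => USWL_eq_zero_of_partner_of_room⟩
end
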